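/- arXiv:2205.11573 — 5 statements merged into one kernel-verified Lean document; each statement's English description precedes it below -/
import Mathlib

section
/- Under Conditions 3* and 4*, the random vector B₀ᵀΓ₀ᵀY is independent of the pair (ΓᵀY, X). -/
open Matrix MeasureTheory ProbabilityTheory

/-- If `V ⊥ W | X` and `W ⊥ X` then `W ⊥ (V, X)`. -/
theorem indepFun_pair_of_condIndepFun
    {Ω α β γ : Type*} [MeasurableSpace Ω] [StandardBorelSpace Ω]
    [MeasurableSpace α] [MeasurableSpace β] [MeasurableSpace γ]
    (P : Measure Ω) [IsProbabilityMeasure P] {W : Ω → α} {V : Ω → β} {X : Ω → γ}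
    (hW : Measurable W) (hV : Measurable V) (hX : Measurable X)
    (h3 : IndepFun W X P)
    (h4 : CondIndepFun (MeasurableSpace.comap X inferInstance) hX.comap_le V W P) :
    IndepFun W (fun ω => (V ω, X ω)) P := by
  have key : ∀ A C D, MeasurableSet A → MeasurableSet C → MeasurableSet D →
      P (W ⁻¹' A ∩ (V ⁻¹' C ∩ X ⁻¹' D)) = P (W ⁻¹' A) * P (V ⁻¹' C ∩ X ⁻¹' D) := by
    intro A C D hA hC hD
    have e1 := (condIndepFun_iff_condExp_inter_preimage_eq_mul hV hW).1 h4 C A hC hA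
    have e2 : P[(W ⁻¹' A).indicator (fun _ => (1:ℝ)) | MeasurableSpace.comap X inferInstance]
        =ᵐ[P] fun _ => P[(W ⁻¹' A).indicator (fun _ => (1:ℝ))] :=
      condExp_indep_eq hW.comap_le hX.comap_le
        (stronglyMeasurable_const.indicator ⟨A, hA, rfl⟩) h3
    have hD' : MeasurableSet[MeasurableSpace.comap X inferInstance] (X ⁻¹' D) := ⟨D, hD, rfl⟩
    have i1 := setIntegral_condExp hX.comap_le (μ := P)
      (f := (V ⁻¹' C ∩ W ⁻¹' A).indicator (fun _ => (1:ℝ)))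
      ((integrable_const _).indicator ((hV hC).inter (hW hA))) hD'
    have i2 := setIntegral_condExp hX.comap_le (μ := P)
      (f := (V ⁻¹' C).indicator (fun _ => (1:ℝ)))
      ((integrable_const _).indicator (hV hC)) hD'
    have e3 : ∫ ω in X ⁻¹' D, (P⟦V ⁻¹' C ∩ W ⁻¹' A | MeasurableSpace.comap X inferInstance⟧) ω ∂P
        = ∫ ω in X ⁻¹' D, (P⟦V ⁻¹' C | MeasurableSpace.comap X inferInstance⟧) ω
          * P.real (W ⁻¹' A) ∂P := by
      apply integral_congr_ae
      apply ae_restrict_of_ae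
      filter_upwards [e1, e2] with ω h1 h2
      rw [h1, h2, integral_indicator_const _ (hW hA)]
      simp
    rw [integral_mul_const, i1, i2, integral_indicator_const _ ((hV hC).inter (hW hA)),
      integral_indicator_const _ (hV hC)] at e3
    simp only [smul_eq_mul, mul_one, measureReal_restrict_apply ((hV hC).inter (hW hA)),
      measureReal_restrict_apply (hV hC)] at e3
    rw [← ENNReal.toReal_eq_toReal_iff' (by finiteness) (by finiteness), ENNReal.toReal_mul]
    rw [show W ⁻¹' A ∩ (V ⁻¹' C ∩ X ⁻¹' D) = V ⁻¹' C ∩ W ⁻¹' A ∩ X ⁻¹' D by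
      ext; simp; tauto, mul_comm]
    exact e3
  rw [indepFun_iff_map_prod_eq_prod_map_map hW.aemeasurable (hV.prodMk hX).aemeasurable]
  symm
  apply Measure.prod_eq_generateFrom (C := {s | MeasurableSet s})
    (D := Set.image2 (· ×ˢ ·) {s : Set β | MeasurableSet s} {t : Set γ | MeasurableSet t})
    MeasurableSpace.generateFrom_measurableSet generateFrom_prod
    MeasurableSpace.isPiSystem_measurableSet isPiSystem_prod
    (Measure.toFiniteSpanningSetsIn _)
    ⟨fun _ => Set.univ, fun _ => ⟨_, MeasurableSet.univ, _, MeasurableSet.univ, Set.univ_prod_univ⟩,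
      fun _ => measure_lt_top _ _, Set.iUnion_const _⟩
  rintro A hA _ ⟨C, hC, D, hD, rfl⟩
  have hA : MeasurableSet A := hA
  have hCD : MeasurableSet (C ×ˢ D) := MeasurableSet.prod hC hD
  change Measure.map _ P (A ×ˢ (C ×ˢ D)) = _ * Measure.map _ P (C ×ˢ D)
  rw [Measure.map_apply (hW.prodMk (hV.prodMk hX)) (hA.prod hCD), Measure.map_apply hW hA,
    Measure.map_apply (hV.prodMk hX) hCD]
  exact key A C D hA hC hD

/-- Under the inner-envelope Conditions 3* and 4*, the random vector `B₀ᵀΓ₀ᵀY` is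
independent of the pair `(ΓᵀY, X)`. -/
theorem innerEnvelope_indep_pair
    {Ω : Type*} [MeasurableSpace Ω] [StandardBorelSpace Ω]
    (P : Measure Ω) [IsProbabilityMeasure P]
    (r p u d : ℕ) (hu : 0 < u) (hd : 0 < d) (hud : u + d < r)
    (Y : Ω → Fin r → ℝ) (X : Ω → Fin p → ℝ)
    (hY : Measurable Y) (hX : Measurable X)
    (Γ : Matrix (Fin r) (Fin u) ℝ) (Γ₀ : Matrix (Fin r) (Fin (r - u)) ℝ)
    (B : Matrix (Fin (r - u)) (Fin d) ℝ) (B₀ : Matrix (Fin (r - u)) (Fin (r - u - d)) ℝ)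
    (hΓ : Γᵀ * Γ = 1) (hΓ₀ : Γ₀ᵀ * Γ₀ = 1) (hΓsum : Γ * Γᵀ + Γ₀ * Γ₀ᵀ = 1)
    (hB : Bᵀ * B = 1) (hB₀ : B₀ᵀ * B₀ = 1) (hBsum : B * Bᵀ + B₀ * B₀ᵀ = 1)
    -- Condition 3*: B₀ᵀΓ₀ᵀY is independent of X
    (cond3 : IndepFun (fun ω => (B₀ᵀ * Γ₀ᵀ).mulVec (Y ω)) X P)
    -- Condition 4*: ΓᵀY and Γ₀ᵀY are conditionally independent given σ(X)
    (cond4 : CondIndepFun (MeasurableSpace.comap X inferInstance) hX.comap_le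
      (fun ω => Γᵀ.mulVec (Y ω)) (fun ω => Γ₀ᵀ.mulVec (Y ω)) P) :
    IndepFun (fun ω => (B₀ᵀ * Γ₀ᵀ).mulVec (Y ω))
      (fun ω => (Γᵀ.mulVec (Y ω), X ω)) P := by
  have m : ∀ {n k : ℕ} (A : Matrix (Fin n) (Fin k) ℝ), Measurable (fun v => A.mulVec v) := by
    intro n k A
    exact (Continuous.matrix_mulVec continuous_const continuous_id).measurable
  refine indepFun_pair_of_condIndepFun P ((m _).comp hY) ((m _).comp hY) hX cond3 ?_
  have h := cond4.comp measurable_id (m B₀ᵀ)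
  have e : (fun ω => (B₀ᵀ * Γ₀ᵀ).mulVec (Y ω))
      = (fun v => B₀ᵀ.mulVec v) ∘ fun ω => Γ₀ᵀ.mulVec (Y ω) := by
    funext ω
    simp only [Function.comp_apply, Matrix.mulVec_mulVec]
  change CondIndepFun _ _ (id ∘ fun ω => Γᵀ.mulVec (Y ω)) (fun ω => (B₀ᵀ * Γ₀ᵀ).mulVec (Y ω)) P
  rw [e]
  exact h
end

section
/- Under Conditions 3* and 4*, let Z = B₀ᵀΓ₀ᵀY, and for bounded measurable g : ℝ^{r−u−d} → ℝ^{d_g} and h : ℝ^{u+p} → ℝ^{d_h} define, for each pair of indices (i, j), f_{ij} = {g_i(Z) − E g_i(Z)}·{h_j(ΓᵀY, X) − E h_j(ΓᵀY, X)}. Then for every (i, j): (a) E[f_{ij} | σ(ΓᵀY, X)] = 0 almost surely; (b) the conditional expectation E[f_{ij} | σ(Γ₀ᵀY, X)] has a version that is measurable with respect to σ(B₀ᵀΓ₀ᵀY, X); (c) E[f_{ij} | σ(B₀ᵀΓ₀ᵀY)] = 0 almost surely; and (d) E[f_{ij} | σ(X)] = 0 almost surely. In particular each f_{ij} belongs to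 the orthogonal nuisance tangent space Λ⊥ of the paper. -/
open Matrix MeasureTheory ProbabilityTheory

/-- Markov property: if `F ⟂ G | K` then conditioning a function of `(K, F)` on `(G, K)` is the
same as conditioning on `K`. -/
theorem condExp_prod_eq_of_condIndepFun {Ω α β γ : Type*} [MeasurableSpace Ω]
    [StandardBorelSpace Ω] (P : Measure Ω) [IsProbabilityMeasure P]
    [MeasurableSpace α] [StandardBorelSpace α] [Nonempty α]
    [MeasurableSpace β] [StandardBorelSpace β] [Nonempty β] [MeasurableSpace γ]
    {F : Ω → α} {G : Ω → β} {K : Ω → γ}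
    (hF : Measurable F) (hG : Measurable G) (hK : Measurable K)
    (hind : CondIndepFun (MeasurableSpace.comap K inferInstance) hK.comap_le G F P)
    (φ : γ × α → ℝ) (hφ : Measurable φ) (hint : Integrable (fun ω => φ (K ω, F ω)) P) :
    P[fun ω => φ (K ω, F ω) | MeasurableSpace.comap (fun ω => (G ω, K ω)) inferInstance]
      =ᵐ[P] P[fun ω => φ (K ω, F ω) | MeasurableSpace.comap K inferInstance] := by
  have hswap : MeasurableSpace.comap (fun ω => (G ω, K ω)) inferInstance
      = MeasurableSpace.comap (fun ω => (K ω, G ω)) inferInstance := by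
    have h1 := comap_measurable (m := inferInstance) (fun ω => (G ω, K ω))
    have h2 := comap_measurable (m := inferInstance) (fun ω => (K ω, G ω))
    apply le_antisymm
    · exact (measurable_swap.comp h2).comap_le
    · exact (measurable_swap.comp h1).comap_le
  rw [hswap]
  have hd := (condIndepFun_iff_condDistrib_prod_ae_eq_prodMkRight hF hG hK).1 hind
  have hd' := ae_of_ae_map (hK.prodMk hG).aemeasurable hd
  have e1 := condExp_prod_ae_eq_integral_condDistrib (μ := P) (hK.prodMk hG) hF.aemeasurable
    (f := fun q : (γ × β) × α => φ (q.1.1, q.2)) (Measurable.stronglyMeasurable (by fun_prop)) hint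
  have e2 := condExp_prod_ae_eq_integral_condDistrib (μ := P) hK hF.aemeasurable
    (f := φ) hφ.stronglyMeasurable hint
  filter_upwards [e1, e2, hd'] with ω h1 h2 h3
  rw [h1, h2, h3]
  rfl

/-- Abstract version of the main theorem, with `Z = T ∘ W`. -/
theorem abstract_orthogonality {Ω α β γ δ : Type*} [MeasurableSpace Ω]
    [StandardBorelSpace Ω] (P : Measure Ω) [IsProbabilityMeasure P]
    [MeasurableSpace α] [StandardBorelSpace α] [Nonempty α]
    [MeasurableSpace β] [StandardBorelSpace β] [Nonempty β] [MeasurableSpace γ]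
    [MeasurableSpace δ]
    {V : Ω → α} {W : Ω → β} {X : Ω → γ} {Z : Ω → δ} (T : β → δ) (hT : Measurable T)
    (hV : Measurable V) (hW : Measurable W) (hX : Measurable X) (hZ : ∀ ω, Z ω = T (W ω))
    (c3 : IndepFun Z X P)
    (c4 : CondIndepFun (MeasurableSpace.comap X inferInstance) hX.comap_le V W P)
    (g : δ → ℝ) (h : γ × α → ℝ) (hg : Measurable g) (hh : Measurable h)
    (Cg Ch : ℝ) (hCg : ∀ z, |g z| ≤ Cg) (hCh : ∀ z, |h z| ≤ Ch)
    (f : Ω → ℝ) (hf : f = (fun ω => g (Z ω)) * (fun ω => h (X ω, V ω)))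
    (hg0 : ∫ ω, g (Z ω) ∂P = 0) (hh0 : ∫ ω, h (X ω, V ω) ∂P = 0) :
    (P[f | MeasurableSpace.comap (fun ω => (V ω, X ω)) inferInstance] =ᵐ[P] 0) ∧
    (∃ φ : Ω → ℝ,
        StronglyMeasurable[MeasurableSpace.comap (fun ω => (Z ω, X ω)) inferInstance] φ ∧
        P[f | MeasurableSpace.comap (fun ω => (W ω, X ω)) inferInstance] =ᵐ[P] φ) ∧
    (P[f | MeasurableSpace.comap Z inferInstance] =ᵐ[P] 0) ∧
    (P[f | MeasurableSpace.comap X inferInstance] =ᵐ[P] 0) := by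
  have hZe : Z = T ∘ W := funext hZ
  have hZm : Measurable Z := hZe ▸ hT.comp hW
  have hGm : Measurable (fun ω => g (Z ω)) := hg.comp hZm
  have hHm : Measurable (fun ω => h (X ω, V ω)) := hh.comp (hX.prodMk hV)
  have hGi : Integrable (fun ω => g (Z ω)) P :=
    Integrable.of_bound hGm.aestronglyMeasurable Cg (ae_of_all _ fun ω => hCg _)
  have hHi : Integrable (fun ω => h (X ω, V ω)) P :=
    Integrable.of_bound hHm.aestronglyMeasurable Ch (ae_of_all _ fun ω => hCh _)
  have hfi : Integrable ((fun ω => g (Z ω)) * (fun ω => h (X ω, V ω))) P :=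
    hHi.bdd_mul hGm.aestronglyMeasurable (ae_of_all _ fun ω => hCg _)
  have hXV := comap_measurable (m := inferInstance) (fun ω => (V ω, X ω))
  have hXW := comap_measurable (m := inferInstance) (fun ω => (W ω, X ω))
  have hXZ := comap_measurable (m := inferInstance) (fun ω => (Z ω, X ω))
  have leV : MeasurableSpace.comap (fun ω => (V ω, X ω)) inferInstance ≤ (inferInstance : MeasurableSpace Ω) :=
    (hV.prodMk hX).comap_le
  have leW : MeasurableSpace.comap (fun ω => (W ω, X ω)) inferInstance ≤ (inferInstance : MeasurableSpace Ω) :=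
    (hW.prodMk hX).comap_le
  have c3' : Indep (MeasurableSpace.comap Z inferInstance) (MeasurableSpace.comap X inferInstance) P :=
    (IndepFun_iff_Indep _ _ _).1 c3
  -- E[g(Z) | V, X] = 0
  have hGX : P[fun ω => g (Z ω) | MeasurableSpace.comap (fun ω => (V ω, X ω)) inferInstance]
      =ᵐ[P] 0 := by
    have e1 := condExp_prod_eq_of_condIndepFun P hW hV hX c4 (fun q => g (T q.2))
      (by fun_prop) (by simpa only [hZ] using hGi)
    have e2 := condExp_indep_eq hZm.comap_le hX.comap_le
      (f := fun ω => g (Z ω)) (hg.comp (comap_measurable (m := inferInstance) Z)).stronglyMeasurable c3'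
    simp only [hg0] at e2
    simp only [← hZ] at e1
    exact e1.trans e2
  -- E[h(X,V) | W, X] = E[h(X,V) | X]
  have hHX := condExp_prod_eq_of_condIndepFun P hV hW hX c4.symm h hh hHi
  have ha : P[f | MeasurableSpace.comap (fun ω => (V ω, X ω)) inferInstance] =ᵐ[P] 0 := by
    rw [hf]
    have e := condExp_mul_of_stronglyMeasurable_right (μ := P)
      (m := MeasurableSpace.comap (fun ω => (V ω, X ω)) inferInstance)
      (f := fun ω => g (Z ω)) (g := fun ω => h (X ω, V ω))
      (hh.comp (measurable_swap.comp hXV)).stronglyMeasurable hfi hGi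
    filter_upwards [e, hGX] with ω h1 h2
    rw [h1]; simp [h2]
  refine ⟨ha, ?_, ?_, ?_⟩
  · refine ⟨(fun ω => g (Z ω)) * P[fun ω => h (X ω, V ω) | MeasurableSpace.comap X inferInstance],
      ?_, ?_⟩
    · apply StronglyMeasurable.mul
      · exact (hg.comp (measurable_fst.comp hXZ)).stronglyMeasurable
      · exact stronglyMeasurable_condExp.mono (measurable_snd.comp hXZ).comap_le
    · rw [hf]
      have e := condExp_mul_of_stronglyMeasurable_left (μ := P)
        (m := MeasurableSpace.comap (fun ω => (W ω, X ω)) inferInstance)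
        (f := fun ω => g (Z ω)) (g := fun ω => h (X ω, V ω))
        (by simp only [hZ]
            exact (hg.comp (hT.comp (measurable_fst.comp hXW))).stronglyMeasurable) hfi hHi
      filter_upwards [e, hHX] with ω h1 h2
      rw [h1]; simp [h2]
  · rw [hf]
    have e := condExp_mul_of_stronglyMeasurable_left (μ := P)
      (m := MeasurableSpace.comap Z inferInstance)
      (f := fun ω => g (Z ω)) (g := fun ω => h (X ω, V ω))
      (hg.comp (comap_measurable (m := inferInstance) Z)).stronglyMeasurable hfi hHi
    have hle : MeasurableSpace.comap Z inferInstance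
        ≤ MeasurableSpace.comap (fun ω => (W ω, X ω)) inferInstance := by
      apply Measurable.comap_le
      rw [hZe]
      exact hT.comp (measurable_fst.comp hXW)
    have t1 := condExp_condExp_of_le (μ := P) (f := fun ω => h (X ω, V ω)) hle leW
    have t2 := condExp_congr_ae (m := MeasurableSpace.comap Z inferInstance) hHX
    have t3 := condExp_indep_eq hX.comap_le hZm.comap_le
      (f := P[fun ω => h (X ω, V ω) | MeasurableSpace.comap X inferInstance])
      stronglyMeasurable_condExp c3'.symm
    rw [integral_condExp hX.comap_le, hh0] at t3
    filter_upwards [e, t1, t2, t3] with ω h1 h2 h3 h4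
    rw [h1]; simp [← h2, h3, h4]
  · have t1 := condExp_condExp_of_le (μ := P) (f := f) (measurable_snd.comp hXV).comap_le leV
    have t2 := condExp_congr_ae (m := MeasurableSpace.comap X inferInstance) ha
    rw [condExp_zero] at t2
    exact t1.symm.trans t2

/-- Under the inner-envelope Conditions 3* and 4*, each centered product
`f_{ij} = {g_i(B₀ᵀΓ₀ᵀY) − E g_i}{h_j(ΓᵀY, X) − E h_j}` lies in the orthogonal
nuisance tangent space `Λ⊥`: (a) `E[f_{ij} | σ(ΓᵀY, X)] = 0` a.s.; (b) `E[f_{ij} | σ(Γ₀ᵀY, X)]`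
has a version measurable w.r.t. `σ(B₀ᵀΓ₀ᵀY, X)`; (c) `E[f_{ij} | σ(B₀ᵀΓ₀ᵀY)] = 0` a.s.;
(d) `E[f_{ij} | σ(X)] = 0` a.s. -/
theorem innerEnvelope_gmm_in_orthogonal_tangent_space
    {Ω : Type*} [MeasurableSpace Ω] [StandardBorelSpace Ω]
    (P : Measure Ω) [IsProbabilityMeasure P]
    (r p u d : ℕ) (hu : 0 < u) (hd : 0 < d) (hud : u + d < r)
    (Y : Ω → Fin r → ℝ) (X : Ω → Fin p → ℝ)
    (hY : Measurable Y) (hX : Measurable X)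
    (Γ : Matrix (Fin r) (Fin u) ℝ) (Γ₀ : Matrix (Fin r) (Fin (r - u)) ℝ)
    (B : Matrix (Fin (r - u)) (Fin d) ℝ) (B₀ : Matrix (Fin (r - u)) (Fin (r - u - d)) ℝ)
    (hΓ : Γᵀ * Γ = 1) (hΓ₀ : Γ₀ᵀ * Γ₀ = 1) (hΓsum : Γ * Γᵀ + Γ₀ * Γ₀ᵀ = 1)
    (hB : Bᵀ * B = 1) (hB₀ : B₀ᵀ * B₀ = 1) (hBsum : B * Bᵀ + B₀ * B₀ᵀ = 1)
    -- Condition 3*: B₀ᵀΓ₀ᵀY is independent of X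
    (cond3 : IndepFun (fun ω => (B₀ᵀ * Γ₀ᵀ).mulVec (Y ω)) X P)
    -- Condition 4*: ΓᵀY and Γ₀ᵀY are conditionally independent given σ(X)
    (cond4 : CondIndepFun (MeasurableSpace.comap X inferInstance) hX.comap_le
      (fun ω => Γᵀ.mulVec (Y ω)) (fun ω => Γ₀ᵀ.mulVec (Y ω)) P)
    (dg dh : ℕ)
    (g : (Fin (r - u - d) → ℝ) → Fin dg → ℝ) (h : (Fin (u + p) → ℝ) → Fin dh → ℝ)
    (hg : Measurable g) (hh : Measurable h)
    (hgbdd : ∃ C, ∀ z i, |g z i| ≤ C) (hhbdd : ∃ C, ∀ w j, |h w j| ≤ C)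
    (f : Fin dg → Fin dh → Ω → ℝ)
    (hf : f = fun i j ω =>
      (g ((B₀ᵀ * Γ₀ᵀ).mulVec (Y ω)) i - ∫ ω', g ((B₀ᵀ * Γ₀ᵀ).mulVec (Y ω')) i ∂P)
        * (h (Fin.append (Γᵀ.mulVec (Y ω)) (X ω)) j
            - ∫ ω', h (Fin.append (Γᵀ.mulVec (Y ω')) (X ω')) j ∂P)) :
    ∀ (i : Fin dg) (j : Fin dh),
      -- (a)
      (P[f i j | MeasurableSpace.comap (fun ω => (Γᵀ.mulVec (Y ω), X ω)) inferInstance]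
        =ᵐ[P] 0) ∧
      -- (b)
      (∃ φ : Ω → ℝ,
        StronglyMeasurable[MeasurableSpace.comap
          (fun ω => ((B₀ᵀ * Γ₀ᵀ).mulVec (Y ω), X ω)) inferInstance] φ ∧
        P[f i j | MeasurableSpace.comap (fun ω => (Γ₀ᵀ.mulVec (Y ω), X ω)) inferInstance]
          =ᵐ[P] φ) ∧
      -- (c)
      (P[f i j | MeasurableSpace.comap (fun ω => (B₀ᵀ * Γ₀ᵀ).mulVec (Y ω)) inferInstance]
        =ᵐ[P] 0) ∧
      -- (d)
      (P[f i j | MeasurableSpace.comap X inferInstance] =ᵐ[P] 0) := by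
  obtain ⟨Cg, hCg⟩ := hgbdd
  obtain ⟨Ch, hCh⟩ := hhbdd
  intro i j
  have mulm : ∀ {m n : ℕ} (M : Matrix (Fin m) (Fin n) ℝ), Measurable (fun v => M.mulVec v) :=
    fun M => (Continuous.matrix_mulVec continuous_const continuous_id).measurable
  have happ : Measurable (fun q : (Fin p → ℝ) × (Fin u → ℝ) => Fin.append q.2 q.1) := by
    refine measurable_pi_lambda _ fun k => ?_
    refine Fin.addCases (fun k => ?_) (fun k => ?_) k
    · simp only [Fin.append_left]; fun_prop
    · simp only [Fin.append_right]; fun_prop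
  have hgi : Measurable (fun z => g z i) := (measurable_pi_apply i).comp hg
  have hhj : Measurable (fun q : (Fin p → ℝ) × (Fin u → ℝ) => h (Fin.append q.2 q.1) j) :=
    (measurable_pi_apply j).comp (hh.comp happ)
  have hVm : Measurable (fun ω => Γᵀ.mulVec (Y ω)) := (mulm Γᵀ).comp hY
  have hWm : Measurable (fun ω => Γ₀ᵀ.mulVec (Y ω)) := (mulm Γ₀ᵀ).comp hY
  have hZm : Measurable (fun ω => (B₀ᵀ * Γ₀ᵀ).mulVec (Y ω)) := (mulm _).comp hY
  have hGi : Integrable (fun ω => g ((B₀ᵀ * Γ₀ᵀ).mulVec (Y ω)) i) P :=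
    Integrable.of_bound (hgi.comp hZm).aestronglyMeasurable Cg (ae_of_all _ fun ω => hCg _ _)
  have hHi : Integrable (fun ω => h (Fin.append (Γᵀ.mulVec (Y ω)) (X ω)) j) P :=
    Integrable.of_bound (hhj.comp (hX.prodMk hVm)).aestronglyMeasurable Ch
      (ae_of_all _ fun ω => hCh _ _)
  have hbd : ∀ a b C : ℝ, |a| ≤ C → |a - b| ≤ C + |b| := fun a b C hab =>
    (abs_sub a b).trans (by linarith)
  refine abstract_orthogonality P (fun w => B₀ᵀ.mulVec w) (mulm _) hVm hWm hX
    (fun ω => by simp [Matrix.mulVec_mulVec]) cond3 cond4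
    (fun z => g z i - ∫ ω', g ((B₀ᵀ * Γ₀ᵀ).mulVec (Y ω')) i ∂P)
    (fun q => h (Fin.append q.2 q.1) j - ∫ ω', h (Fin.append (Γᵀ.mulVec (Y ω')) (X ω')) j ∂P)
    (hgi.sub_const _) (hhj.sub_const _) _ _ (fun z => hbd _ _ Cg (hCg _ _))
    (fun z => hbd _ _ Ch (hCh _ _)) (f i j) (by rw [hf]; rfl) ?_ ?_
  · rw [integral_sub hGi (integrable_const _)]; simp
  · rw [integral_sub hHi (integrable_const _)]; simp
end

section
/- Under Condition 4*, if each entry of Y is integrable, then almost surely (entrywise) E[Y | σ(ΓᵀY, X)] = ΓΓᵀY + E[(I_r − ΓΓᵀ)Y | σ(X)]; equivalently, Y − E(Y | ΓᵀY, X) = Q_Γ Y − E(Q_Γ Y | X) where Q_Γ = I_r − ΓΓᵀ. -/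
open Matrix MeasureTheory ProbabilityTheory

/-- Under Condition 4*, `E[Y | σ(ΓᵀY, X)] = ΓΓᵀY + E[(I − ΓΓᵀ)Y | σ(X)]` entrywise,
equivalently `Y − E(Y | ΓᵀY, X) = Q_Γ Y − E(Q_Γ Y | X)` with `Q_Γ = I − ΓΓᵀ`. -/
theorem condexp_given_projected_response
    {Ω : Type*} [MeasurableSpace Ω] [StandardBorelSpace Ω]
    (P : Measure Ω) [IsProbabilityMeasure P]
    (r p u : ℕ) (hu : 0 < u) (hur : u < r)
    (Y : Ω → Fin r → ℝ) (X : Ω → Fin p → ℝ)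
    (hY : Measurable Y) (hX : Measurable X)
    (Γ : Matrix (Fin r) (Fin u) ℝ) (Γ₀ : Matrix (Fin r) (Fin (r - u)) ℝ)
    (hΓ : Γᵀ * Γ = 1) (hΓ₀ : Γ₀ᵀ * Γ₀ = 1) (hΓsum : Γ * Γᵀ + Γ₀ * Γ₀ᵀ = 1)
    (hint : ∀ i, Integrable (fun ω => Y ω i) P)
    -- Condition 4*: ΓᵀY and Γ₀ᵀY are conditionally independent given σ(X)
    (cond4 : CondIndepFun (MeasurableSpace.comap X inferInstance) hX.comap_le
      (fun ω => Γᵀ.mulVec (Y ω)) (fun ω => Γ₀ᵀ.mulVec (Y ω)) P) :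
    ∀ i : Fin r,
      P[fun ω => Y ω i |
          MeasurableSpace.comap (fun ω => (Γᵀ.mulVec (Y ω), X ω)) inferInstance]
        =ᵐ[P] fun ω => (Γ * Γᵀ).mulVec (Y ω) i +
          (P[fun ω' => ((1 - Γ * Γᵀ)).mulVec (Y ω') i |
              MeasurableSpace.comap X inferInstance]) ω := by
  intro i
  set U : Ω → Fin u → ℝ := fun ω => Γᵀ.mulVec (Y ω) with hUdef
  set V : Ω → Fin (r - u) → ℝ := fun ω => Γ₀ᵀ.mulVec (Y ω) with hVdef
  have hU : Measurable U :=
    (Continuous.matrix_mulVec continuous_const continuous_id).measurable.comp hY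
  have hV : Measurable V :=
    (Continuous.matrix_mulVec continuous_const continuous_id).measurable.comp hY
  have hmul : ∀ A : Matrix (Fin r) (Fin r) ℝ, Integrable (fun ω => A.mulVec (Y ω) i) P := by
    intro A
    simp only [Matrix.mulVec, dotProduct]
    exact integrable_finsetSum _ (fun j _ => (hint j).const_mul _)
  have hQ : ∀ ω, (1 - Γ * Γᵀ).mulVec (Y ω) i = Γ₀.mulVec (V ω) i := by
    intro ω
    rw [← hΓsum, add_sub_cancel_left, hVdef, Matrix.mulVec_mulVec]
  have hQint : Integrable (fun ω => Γ₀.mulVec (V ω) i) P := by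
    have := hmul (1 - Γ * Γᵀ)
    simpa only [hQ] using this
  have hφ : StronglyMeasurable (fun z : Fin (r - u) → ℝ => Γ₀.mulVec z i) :=
    ((continuous_apply i).comp
      (Continuous.matrix_mulVec continuous_const continuous_id)).stronglyMeasurable
  have hm : MeasurableSpace.comap (fun ω => (U ω, X ω)) inferInstance
      = MeasurableSpace.comap (fun ω => (X ω, U ω)) inferInstance := by
    apply le_antisymm
    · rintro _ ⟨s, hs, rfl⟩
      exact ⟨Prod.swap ⁻¹' s, measurable_swap hs, rfl⟩
    · rintro _ ⟨s, hs, rfl⟩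
      exact ⟨Prod.swap ⁻¹' s, measurable_swap hs, rfl⟩
  have hle : MeasurableSpace.comap (fun ω => (U ω, X ω)) inferInstance ≤ ‹MeasurableSpace Ω› :=
    (hU.prodMk hX).comap_le
  have hXU : Measurable (fun ω => (X ω, U ω)) := hX.prodMk hU
  have key := (condIndepFun_iff_condDistrib_prod_ae_eq_prodMkRight hV hU hX).1 cond4
  have key' := ae_of_ae_map hXU.aemeasurable key
  have e1 := condExp_ae_eq_integral_condDistrib hXU hV.aemeasurable hφ hQint
  have e2 := condExp_ae_eq_integral_condDistrib hX hV.aemeasurable hφ hQint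
  have hsplit : (fun ω => Y ω i)
      = (fun ω => (Γ * Γᵀ).mulVec (Y ω) i) + fun ω => Γ₀.mulVec (V ω) i := by
    funext ω
    simp only [Pi.add_apply]
    rw [← hQ, Matrix.sub_mulVec, Matrix.one_mulVec, Pi.sub_apply, add_sub_cancel]
  have hPm : StronglyMeasurable[MeasurableSpace.comap (fun ω => (U ω, X ω)) inferInstance]
      (fun ω => (Γ * Γᵀ).mulVec (Y ω) i) := by
    have h1 : StronglyMeasurable (fun z : (Fin u → ℝ) × (Fin p → ℝ) => Γ.mulVec z.1 i) :=
      ((continuous_apply i).comp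
        (Continuous.matrix_mulVec continuous_const continuous_fst)).stronglyMeasurable
    have h2 := h1.comp_measurable (comap_measurable (fun ω => (U ω, X ω)))
    have h3 : (fun ω => (Γ * Γᵀ).mulVec (Y ω) i)
        = (fun z : (Fin u → ℝ) × (Fin p → ℝ) => Γ.mulVec z.1 i) ∘ (fun ω => (U ω, X ω)) := by
      funext ω
      simp [hUdef, Matrix.mulVec_mulVec]
    rw [h3]
    exact h2
  have hadd := condExp_add (hmul (Γ * Γᵀ)) hQint
    (MeasurableSpace.comap (fun ω => (U ω, X ω)) inferInstance)
  rw [condExp_of_stronglyMeasurable hle hPm (hmul _), ← hsplit] at hadd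
  simp only [hQ]
  rw [← hm] at e1
  filter_upwards [hadd, e1, e2, key'] with ω h1 h2 h3 h4
  rw [h1, Pi.add_apply, h2, h3, h4, Kernel.prodMkRight_apply]
end

section
/- Under Conditions 3* and 4*, if each entry of Y is integrable and E[Y] = 0, then almost surely (entrywise) Y − E[Y | σ(Γ₀ᵀY, X)] + E[Y | σ(B₀ᵀΓ₀ᵀY, X)] − E[Y | σ(B₀ᵀΓ₀ᵀY)] = ΓΓᵀY + E[Γ₀BBᵀΓ₀ᵀY | σ(B₀ᵀΓ₀ᵀY, X)] − E[Γ₀BBᵀΓ₀ᵀY | σ(B₀ᵀΓ₀ᵀY)]. -/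
open Matrix MeasureTheory ProbabilityTheory

lemma condExp_prod_of_condIndepFun
    {Ω β β' γ : Type*} [mΩ : MeasurableSpace Ω] [StandardBorelSpace Ω]
    {P : Measure Ω} [IsProbabilityMeasure P]
    [MeasurableSpace β] [MeasurableSpace β'] [mγ : MeasurableSpace γ]
    [StandardBorelSpace β] [Nonempty β] [StandardBorelSpace β'] [Nonempty β']
    {f : Ω → β} {g : Ω → β'} {k : Ω → γ}
    (hf : Measurable f) (hg : Measurable g) (hk : Measurable k)
    (h : CondIndepFun (MeasurableSpace.comap k inferInstance) hk.comap_le f g P)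
    {φ : β → ℝ} (hφ : Measurable φ) (hint : Integrable (fun ω => φ (f ω)) P) :
    P[fun ω => φ (f ω) | MeasurableSpace.comap (fun ω => (g ω, k ω)) inferInstance]
      =ᵐ[P] P[fun ω => φ (f ω) | MeasurableSpace.comap k inferInstance] := by
  have hc : MeasurableSpace.comap (fun ω => (g ω, k ω)) inferInstance
      = MeasurableSpace.comap (fun ω => (k ω, g ω)) inferInstance := by
    erw [MeasurableSpace.comap_prodMk, MeasurableSpace.comap_prodMk, sup_comm]
  rw [hc]
  have h1 := (condIndepFun_iff_condDistrib_prod_ae_eq_prodMkRight hf hg hk).1 h.symm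
  have h2 := ae_of_ae_map (hk.prodMk hg).aemeasurable h1
  have h3 := condExp_ae_eq_integral_condDistrib (μ := P) (hk.prodMk hg) hf.aemeasurable
    hφ.stronglyMeasurable hint
  have h4 := condExp_ae_eq_integral_condDistrib (μ := P) hk hf.aemeasurable
    hφ.stronglyMeasurable hint
  filter_upwards [h2, h3, h4] with ω e2 e3 e4
  rw [e3, e4, e2, Kernel.prodMkRight_apply]

/-- Under Conditions 3* and 4*, with `E[Y] = 0`, the identity
`Y − E[Y | σ(Γ₀ᵀY, X)] + E[Y | σ(B₀ᵀΓ₀ᵀY, X)] − E[Y | σ(B₀ᵀΓ₀ᵀY)]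
  = ΓΓᵀY + E[P_{Γ₀B} Y | σ(B₀ᵀΓ₀ᵀY, X)] − E[P_{Γ₀B} Y | σ(B₀ᵀΓ₀ᵀY)]`
holds entrywise almost surely, where `P_{Γ₀B} = Γ₀BBᵀΓ₀ᵀ`. -/
theorem efficient_score_delta2_identity
    {Ω : Type*} [MeasurableSpace Ω] [StandardBorelSpace Ω]
    (P : Measure Ω) [IsProbabilityMeasure P]
    (r p u d : ℕ) (hu : 0 < u) (hd : 0 < d) (hud : u + d < r)
    (Y : Ω → Fin r → ℝ) (X : Ω → Fin p → ℝ)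
    (hY : Measurable Y) (hX : Measurable X)
    (Γ : Matrix (Fin r) (Fin u) ℝ) (Γ₀ : Matrix (Fin r) (Fin (r - u)) ℝ)
    (B : Matrix (Fin (r - u)) (Fin d) ℝ) (B₀ : Matrix (Fin (r - u)) (Fin (r - u - d)) ℝ)
    (hΓ : Γᵀ * Γ = 1) (hΓ₀ : Γ₀ᵀ * Γ₀ = 1) (hΓsum : Γ * Γᵀ + Γ₀ * Γ₀ᵀ = 1)
    (hB : Bᵀ * B = 1) (hB₀ : B₀ᵀ * B₀ = 1) (hBsum : B * Bᵀ + B₀ * B₀ᵀ = 1)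
    (hint : ∀ i, Integrable (fun ω => Y ω i) P)
    (hmean : ∀ i, ∫ ω, Y ω i ∂P = 0)
    -- Condition 3*: B₀ᵀΓ₀ᵀY is independent of X
    (cond3 : IndepFun (fun ω => (B₀ᵀ * Γ₀ᵀ).mulVec (Y ω)) X P)
    -- Condition 4*: ΓᵀY and Γ₀ᵀY are conditionally independent given σ(X)
    (cond4 : CondIndepFun (MeasurableSpace.comap X inferInstance) hX.comap_le
      (fun ω => Γᵀ.mulVec (Y ω)) (fun ω => Γ₀ᵀ.mulVec (Y ω)) P) :
    ∀ i : Fin r,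
      (fun ω => Y ω i
          - (P[fun ω' => Y ω' i |
              MeasurableSpace.comap (fun ω' => (Γ₀ᵀ.mulVec (Y ω'), X ω')) inferInstance]) ω
          + (P[fun ω' => Y ω' i |
              MeasurableSpace.comap
                (fun ω' => ((B₀ᵀ * Γ₀ᵀ).mulVec (Y ω'), X ω')) inferInstance]) ω
          - (P[fun ω' => Y ω' i |
              MeasurableSpace.comap (fun ω' => (B₀ᵀ * Γ₀ᵀ).mulVec (Y ω')) inferInstance]) ω)
        =ᵐ[P] fun ω => (Γ * Γᵀ).mulVec (Y ω) i
          + (P[fun ω' => (Γ₀ * B * Bᵀ * Γ₀ᵀ).mulVec (Y ω') i |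
              MeasurableSpace.comap
                (fun ω' => ((B₀ᵀ * Γ₀ᵀ).mulVec (Y ω'), X ω')) inferInstance]) ω
          - (P[fun ω' => (Γ₀ * B * Bᵀ * Γ₀ᵀ).mulVec (Y ω') i |
              MeasurableSpace.comap (fun ω' => (B₀ᵀ * Γ₀ᵀ).mulVec (Y ω')) inferInstance]) ω := by
  intro i
  have mv : ∀ {a b : ℕ} (M : Matrix (Fin a) (Fin b) ℝ), Measurable (fun v => M.mulVec v) := by
    intro a b M
    exact (Continuous.matrix_mulVec continuous_const continuous_id).measurable
  have iv : ∀ {a : ℕ} (M : Matrix (Fin a) (Fin r) ℝ) (j : Fin a),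
      Integrable (fun ω => M.mulVec (Y ω) j) P := by
    intro a M j
    simp only [Matrix.mulVec, dotProduct]
    exact integrable_finsetSum _ fun l _ => (hint l).const_mul _
  have iv0 : ∀ {a : ℕ} (M : Matrix (Fin a) (Fin r) ℝ) (j : Fin a),
      ∫ ω, M.mulVec (Y ω) j ∂P = 0 := by
    intro a M j
    simp only [Matrix.mulVec, dotProduct]
    rw [integral_finsetSum _ fun l _ => (hint l).const_mul _]
    simp [integral_const_mul, hmean]
  set W : Ω → Fin (r - u - d) → ℝ := fun ω => (B₀ᵀ * Γ₀ᵀ).mulVec (Y ω) with hWdef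
  set Z : Ω → Fin (r - u) → ℝ := fun ω => Γ₀ᵀ.mulVec (Y ω) with hZdef
  have hW : Measurable W := (mv _).comp hY
  have hZ : Measurable Z := (mv _).comp hY
  have hV : Measurable (fun ω => Γᵀ.mulVec (Y ω)) := (mv _).comp hY
  have hWZ : W = (fun v => B₀ᵀ.mulVec v) ∘ Z := by
    funext ω; simp [hWdef, hZdef, Matrix.mulVec_mulVec]
  set g : Ω → ℝ := fun ω => (Γ * Γᵀ).mulVec (Y ω) i with hg
  set q : Ω → ℝ := fun ω => (Γ₀ * B * Bᵀ * Γ₀ᵀ).mulVec (Y ω) i with hq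
  set t : Ω → ℝ := fun ω => (Γ₀ * B₀ * (B₀ᵀ * Γ₀ᵀ)).mulVec (Y ω) i with ht
  have gi : Integrable g P := iv _ i
  have qi : Integrable q P := iv _ i
  have ti : Integrable t P := iv _ i
  have hm : (1 : Matrix (Fin r) (Fin r) ℝ)
      = Γ * Γᵀ + (Γ₀ * B * Bᵀ * Γ₀ᵀ + Γ₀ * B₀ * (B₀ᵀ * Γ₀ᵀ)) := by
    rw [← hΓsum]
    congr 1
    calc Γ₀ * Γ₀ᵀ = Γ₀ * (B * Bᵀ + B₀ * B₀ᵀ) * Γ₀ᵀ := by rw [hBsum, Matrix.mul_one]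
      _ = _ := by simp only [Matrix.mul_add, Matrix.add_mul, Matrix.mul_assoc]
  have hYd : (fun ω => Y ω i) = g + (q + t) := by
    funext ω
    have : Y ω i = (1 : Matrix (Fin r) (Fin r) ℝ).mulVec (Y ω) i := by simp
    rw [this, hm]
    simp [hg, hq, ht, Matrix.add_mulVec]
  -- measurability of `t` and `q + t`
  have tW : Measurable[MeasurableSpace.comap W inferInstance] t := by
    have : t = (fun v => (Γ₀ * B₀).mulVec v i) ∘ W := by
      funext ω; simp [ht, hWdef, Matrix.mulVec_mulVec]
    rw [this]
    exact ((measurable_pi_apply i).comp (mv _)).comp (comap_measurable W)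
  have qtZ : Measurable[MeasurableSpace.comap Z inferInstance] (q + t) := by
    have : q + t = (fun v => (Γ₀ * B * Bᵀ + Γ₀ * B₀ * B₀ᵀ).mulVec v i) ∘ Z := by
      funext ω
      simp [hq, ht, hZdef, Matrix.mulVec_mulVec, Matrix.add_mulVec, Matrix.mul_assoc]
    rw [this]
    exact ((measurable_pi_apply i).comp (mv _)).comp (comap_measurable Z)
  have leZ : MeasurableSpace.comap Z inferInstance
      ≤ MeasurableSpace.comap (fun ω => (Z ω, X ω)) inferInstance :=
    (measurable_fst.comp (comap_measurable (fun ω => (Z ω, X ω)))).comap_le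
  have leW : MeasurableSpace.comap W inferInstance
      ≤ MeasurableSpace.comap (fun ω => (W ω, X ω)) inferInstance :=
    (measurable_fst.comp (comap_measurable (fun ω => (W ω, X ω)))).comap_le
  have gV : ∀ ω, g ω = (fun v => Γ.mulVec v i) (Γᵀ.mulVec (Y ω)) := by
    intro ω; simp [hg, Matrix.mulVec_mulVec]
  have gV' : g = fun ω => (fun v => Γ.mulVec v i) (Γᵀ.mulVec (Y ω)) := funext gV
  have hφ : Measurable (fun v : Fin u → ℝ => Γ.mulVec v i) :=
    (measurable_pi_apply i).comp (mv _)
  have e1 : P[g | MeasurableSpace.comap (fun ω => (Z ω, X ω)) inferInstance]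
      =ᵐ[P] P[g | MeasurableSpace.comap X inferInstance] := by
    rw [gV']
    exact condExp_prod_of_condIndepFun hV hZ hX cond4 hφ (gV' ▸ gi)
  have cond4' : CondIndepFun (MeasurableSpace.comap X inferInstance) hX.comap_le
      (fun ω => Γᵀ.mulVec (Y ω)) W P := by
    rw [hWZ]
    exact cond4.comp measurable_id (mv B₀ᵀ)
  have e2 : P[g | MeasurableSpace.comap (fun ω => (W ω, X ω)) inferInstance]
      =ᵐ[P] P[g | MeasurableSpace.comap X inferInstance] := by
    rw [gV']
    exact condExp_prod_of_condIndepFun hV hW hX cond4' hφ (gV' ▸ gi)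
  have e3 : P[g | MeasurableSpace.comap W inferInstance] =ᵐ[P] fun _ => (0 : ℝ) := by
    have a1 := condExp_condExp_of_le (μ := P) (f := g) leW (hW.prodMk hX).comap_le
    have a2 := condExp_congr_ae (m := MeasurableSpace.comap W inferInstance) e2
    have a3 := condExp_indep_eq (μ := P) hX.comap_le hW.comap_le
      (stronglyMeasurable_condExp (μ := P) (f := g)) cond3.symm
    have a4 : ∫ ω, (P[g | MeasurableSpace.comap X inferInstance]) ω ∂P = 0 := by
      rw [integral_condExp hX.comap_le]; exact iv0 _ i
    rw [a4] at a3
    exact a1.symm.trans (a2.trans a3)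
  have c1 : P[q + t | MeasurableSpace.comap (fun ω => (Z ω, X ω)) inferInstance] = q + t :=
    condExp_of_stronglyMeasurable (hZ.prodMk hX).comap_le
      (qtZ.mono leZ le_rfl).stronglyMeasurable (qi.add ti)
  have c2 : P[t | MeasurableSpace.comap (fun ω => (W ω, X ω)) inferInstance] = t :=
    condExp_of_stronglyMeasurable (hW.prodMk hX).comap_le
      (tW.mono leW le_rfl).stronglyMeasurable ti
  have c3 : P[t | MeasurableSpace.comap W inferInstance] = t :=
    condExp_of_stronglyMeasurable hW.comap_le tW.stronglyMeasurable ti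
  have s1 := condExp_add (μ := P) gi (qi.add ti)
    (MeasurableSpace.comap (fun ω => (Z ω, X ω)) inferInstance)
  have s2 := condExp_add (μ := P) gi (qi.add ti)
    (MeasurableSpace.comap (fun ω => (W ω, X ω)) inferInstance)
  have s2' := condExp_add (μ := P) qi ti
    (MeasurableSpace.comap (fun ω => (W ω, X ω)) inferInstance)
  have s3 := condExp_add (μ := P) gi (qi.add ti) (MeasurableSpace.comap W inferInstance)
  have s3' := condExp_add (μ := P) qi ti (MeasurableSpace.comap W inferInstance)
  rw [hYd]
  filter_upwards [e1, e2, e3, s1, s2, s2', s3, s3'] with ω e1 e2 e3 s1 s2 s2' s3 s3'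
  have hy : Y ω i = g ω + (q ω + t ω) := congrFun hYd ω
  rw [c1] at s1
  rw [c2] at s2'
  rw [c3] at s3'
  simp only [Pi.add_apply] at s1 s2 s2' s3 s3'
  rw [s1, s2, s3, s2', s3', e1, e2, e3, hy]
  ring
end

section
/- Let A, B ∈ ℝ^{r×τ} be semi-orthogonal matrices, i.e., AᵀA = BᵀB = I_τ. If det(BᵀAAᵀB) = 1, then the column span of A equals the column span of B. -/
open Matrix

/-- If the Hotelling vector correlation coefficient `q²(A, B) = det(BᵀAAᵀB)` of two
semi-orthogonal matrices `A, B ∈ ℝ^{r×τ}` equals 1, then the column span of `A`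
equals the column span of `B`. -/
theorem hotelling_vector_correlation_eq_one (r τ : ℕ)
    (A B : Matrix (Fin r) (Fin τ) ℝ)
    (hA : Aᵀ * A = 1) (hB : Bᵀ * B = 1)
    (hdet : (Bᵀ * A * Aᵀ * B).det = 1) :
    LinearMap.range A.mulVecLin = LinearMap.range B.mulVecLin := by
  have hM : Bᵀ * A * Aᵀ * B = (Aᵀ * B)ᴴ * (Aᵀ * B) := by
    simp [conjTranspose_eq_transpose_of_trivial, Matrix.mul_assoc]
  have hpos : (Bᵀ * A * Aᵀ * B).PosSemidef := by
    rw [hM]; exact posSemidef_conjTranspose_mul_self _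
  have hH := hpos.isHermitian
  have htr : (τ : ℝ) ≤ (Bᵀ * A * Aᵀ * B).trace := by
    have h1 : ∏ i, hH.eigenvalues i = 1 := by
      have := hH.det_eq_prod_eigenvalues
      rw [hdet] at this
      simpa using this.symm
    have hne : ∀ i, hH.eigenvalues i ≠ 0 := by
      intro i h0
      rw [Finset.prod_eq_zero (Finset.mem_univ i) h0] at h1
      exact zero_ne_one h1
    have hlog : ∑ i, Real.log (hH.eigenvalues i) = 0 := by
      rw [← Real.log_prod (fun i _ => hne i), h1, Real.log_one]
    have hle : ∑ i, Real.log (hH.eigenvalues i) ≤ ∑ i, (hH.eigenvalues i - 1) :=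
      Finset.sum_le_sum fun i _ => Real.log_le_sub_one_of_pos
        (lt_of_le_of_ne (hpos.eigenvalues_nonneg i) (hne i).symm)
    have ht := hH.trace_eq_sum_eigenvalues
    simp at ht
    simp at hle
    linarith
  have hE : (B - A * (Aᵀ * B))ᴴ * (B - A * (Aᵀ * B)) = 1 - Bᵀ * A * Aᵀ * B := by
    have h2 : Aᵀ * (A * (Aᵀ * B)) = Aᵀ * B := by
      rw [← Matrix.mul_assoc, hA, Matrix.one_mul]
    simp [conjTranspose_eq_transpose_of_trivial, Matrix.mul_assoc, Matrix.sub_mul,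
      Matrix.mul_sub, hB, h2]
  have hE0 : B - A * (Aᵀ * B) = 0 := by
    rw [← trace_conjTranspose_mul_self_eq_zero_iff]
    apply le_antisymm
    · rw [hE, trace_sub, trace_one]
      simpa using htr
    · exact (posSemidef_conjTranspose_mul_self _).trace_nonneg
  have hBA : B = A * (Aᵀ * B) := sub_eq_zero.mp hE0
  have hC : (Aᵀ * B)ᵀ * (Aᵀ * B) = 1 := by
    rw [hE0, Matrix.mul_zero] at hE
    rw [← conjTranspose_eq_transpose_of_trivial, ← hM]
    exact (sub_eq_zero.mp hE.symm).symm
  have hAB : A = B * (Aᵀ * B)ᵀ := by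
    have h3 : A * (Aᵀ * B) * (Aᵀ * B)ᵀ = A := by
      rw [Matrix.mul_assoc, mul_eq_one_comm.mp hC, Matrix.mul_one]
    rw [← hBA] at h3
    exact h3.symm
  apply le_antisymm
  · rw [hAB, mulVecLin_mul]
    exact LinearMap.range_comp_le_range _ _
  · rw [hBA, mulVecLin_mul]
    exact LinearMap.range_comp_le_range _ _
end
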